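/- Let β > 1. Then for Lebesgue-almost all x ∈ [0,1), lim_{n→∞} l_n(x)/√(n·log log n) = 0 and lim_{n→∞} (log q_{k_n(x)}(x) − (log β/2)·n)/√(n·log log n) = 0. -/

import Mathlib

open MeasureTheory Filter Set

/-- The β-transformation `T_β x = βx - ⌊βx⌋` on `[0,1)`. -/
noncomputable def betaT (β : ℝ) (x : ℝ) : ℝ := β * x - ⌊β * x⌋

/-- The `i`-th digit (for `i ≥ 1`) of the β-expansion of `x`. -/
noncomputable def betaEps (β : ℝ) (i : ℕ) (x : ℝ) : ℤ := ⌊β * (betaT β)^[i - 1] x⌋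

/-- The cylinder of order `n` of the β-expansion containing `x`. -/
def betaCyl (β : ℝ) (n : ℕ) (x : ℝ) : Set ℝ :=
  {y ∈ Set.Ico (0:ℝ) 1 | ∀ i, 1 ≤ i → i ≤ n → betaEps β i y = betaEps β i x}

/-- The Gauss map, with `T 0 = 0`. -/
noncomputable def gaussMap (x : ℝ) : ℝ := if x = 0 then 0 else 1 / x - ⌊1 / x⌋

/-- The `i`-th partial quotient (for `i ≥ 1`) of the continued fraction expansion of `x`. -/
noncomputable def cfA (i : ℕ) (x : ℝ) : ℤ := ⌊1 / (gaussMap^[i - 1] x)⌋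

/-- The cylinder of order `m` of the continued fraction expansion containing `x`. -/
def cfCyl (m : ℕ) (x : ℝ) : Set ℝ :=
  {y ∈ Set.Ico (0:ℝ) 1 | ∀ i, 1 ≤ i → i ≤ m → cfA i y = cfA i x}

/-- `k_n(x)`: the exact number of partial quotients of the continued fraction of `x`
determined by the first `n` β-expansion digits of `x`. -/
noncomputable def kCF (β : ℝ) (n : ℕ) (x : ℝ) : ℕ :=
  sSup {m | betaCyl β n x ⊆ cfCyl m x}

/-- Denominators `q_n(x)` of the continued fraction convergents of `x`
(`q_0 = 1`, `q_1 = a_1`, `q_n = a_n q_{n-1} + q_{n-2}`). -/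
noncomputable def cfQ (x : ℝ) : ℕ → ℤ
  | 0 => 1
  | 1 => cfA 1 x
  | (n + 2) => cfA (n + 2) x * cfQ x (n + 1) + cfQ x n

/-- Numerators `p_n(x)` of the continued fraction convergents of `x`
(`p_0 = 0`, `p_1 = 1`, `p_n = a_n p_{n-1} + p_{n-2}`). -/
noncomputable def cfP (x : ℝ) : ℕ → ℤ
  | 0 => 0
  | 1 => 1
  | (n + 2) => cfA (n + 2) x * cfP x (n + 1) + cfP x n

/-- `l_n(x)`: the length of the longest string of zeros just after the `n`-th digit
of the β-expansion of `x`. -/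
noncomputable def lZero (β : ℝ) (n : ℕ) (x : ℝ) : ℕ :=
  sSup {k | ∀ j, 1 ≤ j → j ≤ k → betaEps β (n + j) x = 0}

lemma betaT_nonneg (β x : ℝ) : 0 ≤ betaT β x := by
  unfold betaT; linarith [Int.floor_le (β * x)]

lemma betaT_lt_one (β x : ℝ) : betaT β x < 1 := by
  unfold betaT; linarith [Int.lt_floor_add_one (β * x)]

lemma measurable_betaT (β : ℝ) : Measurable (betaT β) := by
  unfold betaT
  have h : Measurable (fun x : ℝ => β * x) := measurable_const_mul β
  exact h.sub ((measurable_from_top (f := fun z : ℤ => (z : ℝ))).comp (Int.measurable_floor.comp h))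

/-- Lebesgue measure of `B ∩ [0,t)`. -/
noncomputable def FF (B : Set ℝ) (t : ℝ) : ℝ := volume.real (B ∩ Ico 0 t)

lemma FF_nonneg (B : Set ℝ) (t : ℝ) : 0 ≤ FF B t := measureReal_nonneg

lemma vol_affine (β : ℝ) (hβ : 1 < β) (j : ℝ) (S : Set ℝ) :
    volume {x : ℝ | β * x - j ∈ S} = ENNReal.ofReal β⁻¹ * volume S := by
  have h : {x : ℝ | β * x - j ∈ S} = (fun x => β * x) ⁻¹' ((fun x => x + (-j)) ⁻¹' S) := by
    ext x; simp [sub_eq_add_neg]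
  rw [h, Real.volume_preimage_mul_left (by linarith), measure_preimage_add_right,
    abs_of_pos (by positivity)]

lemma volr_affine (β : ℝ) (hβ : 1 < β) (j : ℝ) (S : Set ℝ) :
    volume.real {x : ℝ | β * x - j ∈ S} = β⁻¹ * volume.real S := by
  rw [measureReal_def, vol_affine β hβ, ENNReal.toReal_mul,
    ENNReal.toReal_ofReal (by positivity), measureReal_def]

lemma fin_inter (B : Set ℝ) (t : ℝ) : volume (B ∩ Ico 0 t) ≠ ⊤ :=
  ne_top_of_le_ne_top (by simp) (measure_mono (inter_subset_right (s := B) (t := Ico 0 t)))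

lemma FF_step (β : ℝ) (hβ : 1 < β) (B : Set ℝ) (t : ℝ) (ht : 0 ≤ t) :
    FF (betaT β ⁻¹' B) t ≤ β⁻¹ * (⌊β * t⌋ * FF B 1 + FF B (betaT β t)) := by
  have hN : ((⌊β * t⌋.toNat : ℕ) : ℤ) = ⌊β * t⌋ :=
    Int.toNat_of_nonneg (Int.floor_nonneg.2 (by positivity))
  set N := ⌊β * t⌋.toNat with hNdef
  have hsub : betaT β ⁻¹' B ∩ Ico 0 t ⊆
      (⋃ j ∈ Finset.range N, {x : ℝ | β * x - (j:ℝ) ∈ B ∩ Ico 0 1}) ∪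
        {x : ℝ | β * x - (N:ℝ) ∈ B ∩ Ico 0 (betaT β t)} := by
    rintro x ⟨hxB, hx0, hxt⟩
    have hj : ((⌊β * x⌋.toNat : ℕ) : ℤ) = ⌊β * x⌋ :=
      Int.toNat_of_nonneg (Int.floor_nonneg.2 (by positivity))
    have hjR : ((⌊β * x⌋.toNat : ℕ) : ℝ) = (⌊β * x⌋ : ℝ) := by exact_mod_cast hj
    have hNR : (N : ℝ) = (⌊β * t⌋ : ℝ) := by exact_mod_cast hN
    have hle : ⌊β * x⌋ ≤ ⌊β * t⌋ := Int.floor_le_floor (by nlinarith)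
    have hxB' : betaT β x ∈ B := hxB
    rcases hle.lt_or_eq with h | h
    · left
      simp only [mem_iUnion, Finset.mem_range]
      refine ⟨⌊β * x⌋.toNat, by omega, ?_⟩
      rw [mem_ofPred_eq]
      rw [hjR]
      exact ⟨hxB', betaT_nonneg β x, betaT_lt_one β x⟩
    · right
      rw [mem_ofPred_eq]
      rw [hNR, ← h]
      refine ⟨hxB', betaT_nonneg β x, ?_⟩
      unfold betaT
      rw [← h]
      nlinarith
  have fin1 : ∀ (j : ℝ) (s : ℝ), volume {x : ℝ | β * x - j ∈ B ∩ Ico 0 s} ≠ ⊤ := by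
    intro j s
    rw [vol_affine β hβ]
    exact ENNReal.mul_ne_top ENNReal.ofReal_ne_top (fin_inter B s)
  have fin2 : volume (⋃ j ∈ Finset.range N, {x : ℝ | β * x - (j:ℝ) ∈ B ∩ Ico 0 1}) ≠ ⊤ := by
    refine ne_top_of_le_ne_top ?_ (measure_biUnion_finset_le _ _)
    exact ENNReal.sum_ne_top.2 (fun j _ => fin1 j 1)
  have e1 : FF (betaT β ⁻¹' B) t ≤ volume.real ((⋃ j ∈ Finset.range N, {x : ℝ | β * x - (j:ℝ) ∈ B ∩ Ico 0 1}) ∪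
        {x : ℝ | β * x - (N:ℝ) ∈ B ∩ Ico 0 (betaT β t)}) :=
    measureReal_mono hsub (by
      refine ne_top_of_le_ne_top ?_ (measure_union_le _ _)
      exact ENNReal.add_ne_top.2 ⟨fin2, fin1 _ _⟩)
  have e2 := measureReal_union_le (μ := volume) (⋃ j ∈ Finset.range N, {x : ℝ | β * x - (j:ℝ) ∈ B ∩ Ico 0 1})
        {x : ℝ | β * x - (N:ℝ) ∈ B ∩ Ico 0 (betaT β t)}
  have e3 := measureReal_biUnion_finset_le (μ := volume) (Finset.range N) (fun j : ℕ => {x : ℝ | β * x - (j:ℝ) ∈ B ∩ Ico 0 1})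
  simp only [volr_affine β hβ, Finset.sum_const, Finset.card_range, nsmul_eq_mul] at e2 e3
  have hNR : (N : ℝ) = (⌊β * t⌋ : ℝ) := by exact_mod_cast hN
  unfold FF at *
  rw [← hNR]
  calc _ ≤ _ := e1
    _ ≤ _ := e2
    _ ≤ _ := add_le_add_left e3 _
    _ = _ := by ring

lemma tau_nonneg (β : ℝ) (k : ℕ) : 0 ≤ (betaT β)^[k] 1 := by
  cases k with
  | zero => simp
  | succ k => rw [Function.iterate_succ_apply']; exact betaT_nonneg _ _

lemma dig_sum (β : ℝ) (hβ : 1 < β) (N : ℕ) :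
    ∑ k ∈ Finset.range N, (β⁻¹)^(k+1) * (⌊β * (betaT β)^[k] 1⌋ : ℝ) = 1 - (β⁻¹)^N * (betaT β)^[N] 1 := by
  induction N with
  | zero => simp
  | succ N ih =>
    rw [Finset.sum_range_succ, ih, Function.iterate_succ_apply']
    have : β⁻¹ * β = 1 := inv_mul_cancel₀ (by linarith)
    conv_rhs => rw [betaT]
    rw [pow_succ]
    linear_combination ((β⁻¹)^N * (betaT β)^[N] 1) * this

lemma Q_step (β : ℝ) (hβ : 1 < β) (B : Set ℝ) (N : ℕ) :
    ∑ k ∈ Finset.range (N+1), (β⁻¹)^k * FF (betaT β ⁻¹' B) ((betaT β)^[k] 1) ≤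
    ∑ k ∈ Finset.range (N+2), (β⁻¹)^k * FF B ((betaT β)^[k] 1) := by
  rw [Finset.sum_range_succ' _ (N+1)]
  have h1 : ∀ k, (β⁻¹)^k * FF (betaT β ⁻¹' B) ((betaT β)^[k] 1) ≤
      (β⁻¹)^(k+1) * (⌊β * (betaT β)^[k] 1⌋ : ℝ) * FF B 1 + (β⁻¹)^(k+1) * FF B ((betaT β)^[k+1] 1) := by
    intro k
    have := FF_step β hβ B _ (tau_nonneg β k)
    have hp : 0 ≤ (β⁻¹)^k := by positivity
    have := mul_le_mul_of_nonneg_left this hp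
    rw [Function.iterate_succ_apply']
    refine this.trans (le_of_eq ?_)
    ring
  refine (Finset.sum_le_sum (fun k _ => h1 k)).trans ?_
  rw [Finset.sum_add_distrib, ← Finset.sum_mul, dig_sum β hβ]
  have : 0 ≤ (β⁻¹)^(N+1) * (betaT β)^[N+1] 1 := mul_nonneg (by positivity) (tau_nonneg _ _)
  have h3 := FF_nonneg B 1
  simp only [pow_zero, Function.iterate_zero, id, one_mul]
  nlinarith

lemma Q_iter (β : ℝ) (hβ : 1 < β) (n : ℕ) : ∀ (B : Set ℝ) (N : ℕ),
    ∑ k ∈ Finset.range (N+1), (β⁻¹)^k * FF ((betaT β)^[n] ⁻¹' B) ((betaT β)^[k] 1) ≤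
    ∑ k ∈ Finset.range (N+n+1), (β⁻¹)^k * FF B ((betaT β)^[k] 1) := by
  induction n with
  | zero => intro B N; simp
  | succ n ih =>
    intro B N
    have h : (betaT β)^[n+1] ⁻¹' B = betaT β ⁻¹' ((betaT β)^[n] ⁻¹' B) := by
      ext x; simp
    rw [h]
    refine (Q_step β hβ _ N).trans ((ih B (N+1)).trans (le_of_eq ?_))
    congr 2; ring

lemma beta_meas (β : ℝ) (hβ : 1 < β) (n : ℕ) (δ : ℝ) (hδ : 0 ≤ δ) :
    volume ({x | (betaT β)^[n] x < δ} ∩ Ico 0 1) ≤ ENNReal.ofReal ((1 - β⁻¹)⁻¹ * δ) := by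
  have key := Q_iter β hβ n (Iio δ) 0
  simp only [zero_add, Finset.range_one, Finset.sum_singleton, pow_zero, one_mul, Function.iterate_zero, id] at key
  have hF : ∀ t, FF (Iio δ) t ≤ δ := by
    intro t
    have : Iio δ ∩ Ico 0 t ⊆ Ico 0 δ := by rintro x ⟨h1, h2, h3⟩; exact ⟨h2, h1⟩
    refine (measureReal_mono this (by simp)).trans ?_
    simp [hδ]
  have hb0 : 0 ≤ β⁻¹ := by positivity
  have hb : β⁻¹ < 1 := inv_lt_one_of_one_lt₀ hβ
  have h2 : ∑ k ∈ Finset.range (n+1), (β⁻¹)^k * FF (Iio δ) ((betaT β)^[k] 1) ≤ (1 - β⁻¹)⁻¹ * δ := by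
    calc _ ≤ ∑ k ∈ Finset.range (n+1), (β⁻¹)^k * δ :=
          Finset.sum_le_sum (fun k _ => mul_le_mul_of_nonneg_left (hF _) (by positivity))
      _ = (∑ k ∈ Finset.range (n+1), (β⁻¹)^k) * δ := by rw [Finset.sum_mul]
      _ ≤ _ := by
        refine mul_le_mul_of_nonneg_right ?_ hδ
        rw [← tsum_geometric_of_lt_one hb0 hb]
        exact (summable_geometric_of_lt_one hb0 hb).sum_le_tsum _ (fun i _ => by positivity)
  have h3 := key.trans h2
  rw [ENNReal.le_ofReal_iff_toReal_le (fin_inter _ _) (mul_nonneg (inv_nonneg.2 (by linarith)) hδ)]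
  exact h3

lemma beta_ae (β : ℝ) (hβ : 1 < β) : ∀ᵐ x ∂(volume.restrict (Set.Ico (0:ℝ) 1)),
    ∀ᶠ n : ℕ in atTop, 1 / (n:ℝ)^2 ≤ (betaT β)^[n] x := by
  have h := ae_eventually_notMem (μ := volume.restrict (Set.Ico (0:ℝ) 1))
    (s := fun n : ℕ => {x | (betaT β)^[n] x < 1 / (n:ℝ)^2}) ?_
  · filter_upwards [h] with x hx
    filter_upwards [hx] with n hn
    simpa using hn
  · have hs : Summable (fun n : ℕ => (1 - β⁻¹)⁻¹ * (1 / (n:ℝ)^2)) :=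
      (Real.summable_one_div_nat_pow.2 (by norm_num)).mul_left _
    refine ne_top_of_le_ne_top hs.tsum_ofReal_ne_top (ENNReal.tsum_le_tsum fun n => ?_)
    rw [Measure.restrict_apply' measurableSet_Ico]
    exact beta_meas β hβ n _ (by positivity)
lemma gauss_nonneg (x : ℝ) : 0 ≤ gaussMap x := by
  unfold gaussMap; split_ifs
  · exact le_rfl
  · linarith [Int.floor_le (1 / x)]

lemma gauss_lt_one (x : ℝ) : gaussMap x < 1 := by
  unfold gaussMap; split_ifs
  · norm_num
  · linarith [Int.lt_floor_add_one (1 / x)]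

lemma measurable_gauss : Measurable gaussMap := by
  unfold gaussMap
  refine Measurable.ite (measurableSet_singleton 0) measurable_const ?_
  have h : Measurable (fun x : ℝ => 1 / x) := measurable_const.div measurable_id
  exact h.sub ((measurable_from_top (f := fun z : ℤ => (z : ℝ))).comp (Int.measurable_floor.comp h))

/-- Gauss density. -/
noncomputable def gh (x : ℝ) : ENNReal := ENNReal.ofReal (1 / (1 + x))

/-- Gauss measure (unnormalized). -/
noncomputable def gnu (A : Set ℝ) : ENNReal := ∫⁻ x in A ∩ Ico 0 1, gh x

lemma gh_tsum (x : ℝ) (hx : 0 ≤ x) :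
    ∑' k : ℕ, ENNReal.ofReal |-(1 / ((k:ℝ) + 1 + x)^2)| * gh (1 / ((k:ℝ) + 1 + x)) ≤ gh x := by
  have h1 : ∀ k : ℕ, ENNReal.ofReal |-(1 / ((k:ℝ) + 1 + x)^2)| * gh (1 / ((k:ℝ) + 1 + x)) =
      ENNReal.ofReal (1 / ((k:ℝ) + 1 + x) - 1 / (((k+1:ℕ):ℝ) + 1 + x)) := by
    intro k
    unfold gh
    rw [← ENNReal.ofReal_mul (abs_nonneg _), abs_neg, abs_of_nonneg (by positivity)]
    congr 1
    push_cast
    field_simp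
    ring
  simp_rw [h1]
  rw [ENNReal.tsum_eq_iSup_nat]
  refine iSup_le fun n => ?_
  rw [← ENNReal.ofReal_sum_of_nonneg]
  · rw [Finset.sum_range_sub' (fun k : ℕ => 1 / ((k:ℝ) + 1 + x))]
    refine ENNReal.ofReal_le_ofReal ?_
    have : 0 ≤ 1 / ((n:ℝ) + 1 + x) := by positivity
    simp only [Nat.cast_zero, zero_add]
    linarith
  · intro k _
    rw [sub_nonneg]
    refine one_div_le_one_div_of_le (by positivity) ?_
    push_cast; linarith

lemma gnu_step (A : Set ℝ) (hA : MeasurableSet A) : gnu (gaussMap ⁻¹' A) ≤ gnu A := by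
  set C := A ∩ Ico (0:ℝ) 1 with hC
  have hCm : MeasurableSet C := hA.inter measurableSet_Ico
  set f : ℕ → ℝ → ℝ := fun k x => 1 / ((k:ℝ) + 1 + x) with hf
  have hsub : gaussMap ⁻¹' A ∩ Ico 0 1 ⊆ {0} ∪ ⋃ k, f k '' C := by
    rintro x ⟨hxA, hx0, hx1⟩
    rcases hx0.eq_or_lt with h | h
    · left; exact h.symm
    right
    have hxA' : gaussMap x ∈ A := hxA
    have h1 : 1 ≤ ⌊1 / x⌋ := by
      rw [Int.le_floor]; push_cast; rw [le_div_iff₀ h]; linarith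
    rw [mem_iUnion]
    refine ⟨(⌊1 / x⌋ - 1).toNat, gaussMap x, ⟨hxA', gauss_nonneg x, gauss_lt_one x⟩, ?_⟩
    have h2 : (((⌊1 / x⌋ - 1).toNat : ℕ) : ℤ) = ⌊1 / x⌋ - 1 := Int.toNat_of_nonneg (by omega)
    have h3 : (((⌊1 / x⌋ - 1).toNat : ℕ) : ℝ) = (⌊1 / x⌋ : ℝ) - 1 := by exact_mod_cast h2
    simp only [hf]
    rw [h3, gaussMap, if_neg h.ne']
    have : (⌊1 / x⌋ : ℝ) - 1 + 1 + (1 / x - ⌊1 / x⌋) = 1 / x := by ring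
    rw [this]; simp
  have hder : ∀ k : ℕ, ∀ x ∈ C, HasDerivWithinAt (f k) (-(1 / ((k:ℝ) + 1 + x)^2)) C x := by
    intro k x hx
    have hx0 : 0 ≤ x := hx.2.1
    have hne : (k:ℝ) + 1 + x ≠ 0 := by positivity
    have h : HasDerivAt (fun y : ℝ => ((k:ℝ)+1+y)⁻¹) (-1 / ((k:ℝ)+1+x)^2) x :=
      ((hasDerivAt_id x).const_add ((k:ℝ)+1)).inv hne
    have hfk : f k = fun x => ((k:ℝ)+1+x)⁻¹ := by ext y; simp [f]
    rw [hfk]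
    refine HasDerivAt.hasDerivWithinAt ?_
    rw [← neg_div]
    exact h
  have hinj : ∀ k : ℕ, InjOn (f k) C := by
    intro k x hx y hy hxy
    have hx0 : 0 ≤ x := hx.2.1
    have hy0 : 0 ≤ y := hy.2.1
    simp only [hf, one_div] at hxy
    have := inv_injective hxy
    linarith
  calc gnu (gaussMap ⁻¹' A) ≤ ∫⁻ x in {0} ∪ ⋃ k, f k '' C, gh x := lintegral_mono_set hsub
    _ ≤ (∫⁻ x in {0}, gh x) + ∫⁻ x in ⋃ k, f k '' C, gh x := lintegral_union_le _ _ _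
    _ = ∫⁻ x in ⋃ k, f k '' C, gh x := by simp
    _ ≤ ∑' k, ∫⁻ x in f k '' C, gh x := lintegral_iUnion_le _ _
    _ = ∑' k : ℕ, ∫⁻ x in C, ENNReal.ofReal |-(1 / ((k:ℝ) + 1 + x)^2)| * gh (f k x) := by
        congr 1; ext k
        exact lintegral_image_eq_lintegral_abs_deriv_mul hCm (hder k) (hinj k) _
    _ = ∫⁻ x in C, ∑' k : ℕ, ENNReal.ofReal |-(1 / ((k:ℝ) + 1 + x)^2)| * gh (f k x) := by
        rw [lintegral_tsum]
        intro k
        simp only [hf, gh]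
        fun_prop
    _ ≤ gnu A := by
        refine setLIntegral_mono_ae' hCm (ae_of_all _ fun x hx => gh_tsum x hx.2.1)

lemma gnu_iter (A : Set ℝ) (hA : MeasurableSet A) (n : ℕ) : gnu (gaussMap^[n] ⁻¹' A) ≤ gnu A := by
  induction n with
  | zero => simp
  | succ n ih =>
    have h : gaussMap^[n+1] ⁻¹' A = gaussMap ⁻¹' (gaussMap^[n] ⁻¹' A) := by
      ext x; simp
    rw [h]
    exact (gnu_step _ ((measurable_gauss.iterate n) hA)).trans ih

lemma gauss_meas (A : Set ℝ) (hA : MeasurableSet A) (n : ℕ) :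
    volume (gaussMap^[n] ⁻¹' A ∩ Ico 0 1) ≤ 2 * volume (A ∩ Ico 0 1) := by
  have h := gnu_iter A hA n
  have hB : MeasurableSet (gaussMap^[n] ⁻¹' A ∩ Ico 0 1) :=
    ((measurable_gauss.iterate n) hA).inter measurableSet_Ico
  have h1 : ENNReal.ofReal (1/2) * volume (gaussMap^[n] ⁻¹' A ∩ Ico 0 1) ≤ gnu (gaussMap^[n] ⁻¹' A) := by
    rw [← setLIntegral_const]
    refine setLIntegral_mono_ae' hB (ae_of_all _ fun x hx => ENNReal.ofReal_le_ofReal ?_)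
    have h0 : 0 ≤ x := hx.2.1
    have h1 : x < 1 := hx.2.2
    exact one_div_le_one_div_of_le (by linarith) (by linarith)
  have h2 : gnu A ≤ 1 * volume (A ∩ Ico 0 1) := by
    rw [← setLIntegral_const]
    refine setLIntegral_mono_ae' (hA.inter measurableSet_Ico) (ae_of_all _ fun x hx => ?_)
    have h0 : 0 ≤ x := hx.2.1
    unfold gh
    rw [← ENNReal.ofReal_one]
    refine ENNReal.ofReal_le_ofReal ?_
    rw [div_le_one (by linarith)]; linarith
  have h3 := h1.trans (h.trans h2)
  calc _ = 2 * (ENNReal.ofReal (1/2) * volume (gaussMap^[n] ⁻¹' A ∩ Ico 0 1)) := by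
        rw [← mul_assoc, show (2:ENNReal) = ENNReal.ofReal 2 by simp, ← ENNReal.ofReal_mul (by norm_num)]
        norm_num
    _ ≤ _ := by rw [one_mul] at h3; gcongr

lemma gauss_ae : ∀ᵐ x ∂(volume.restrict (Set.Ico (0:ℝ) 1)),
    ∀ᶠ n : ℕ in atTop, 1 / ((n:ℝ)+1)^2 ≤ gaussMap^[n] x ∧ 1 / ((n:ℝ)+1)^2 ≤ 1 - gaussMap^[n] x := by
  have hs0 : Summable (fun n : ℕ => 1 / ((n:ℝ)+1)^2) := by
    have := (summable_nat_add_iff 1).2 (Real.summable_one_div_nat_pow.2 (by norm_num : 1 < 2))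
    simpa using this
  have hs : Summable (fun n : ℕ => 2 * (1 / ((n:ℝ)+1)^2)) := hs0.mul_left _
  have h1 := ae_eventually_notMem (μ := volume.restrict (Set.Ico (0:ℝ) 1))
    (s := fun n : ℕ => gaussMap^[n] ⁻¹' (Iio (1 / ((n:ℝ)+1)^2))) ?_
  · have h2 := ae_eventually_notMem (μ := volume.restrict (Set.Ico (0:ℝ) 1))
      (s := fun n : ℕ => gaussMap^[n] ⁻¹' (Ioi (1 - 1 / ((n:ℝ)+1)^2))) ?_
    · filter_upwards [h1, h2] with x hx hx2
      filter_upwards [hx, hx2] with n hn hn2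
      simp only [mem_preimage, mem_Iio, mem_Ioi, not_lt] at hn hn2
      exact ⟨hn, by linarith⟩
    · refine ne_top_of_le_ne_top hs.tsum_ofReal_ne_top (ENNReal.tsum_le_tsum fun n => ?_)
      rw [Measure.restrict_apply' measurableSet_Ico]
      refine (gauss_meas _ measurableSet_Ioi n).trans ?_
      rw [ENNReal.ofReal_mul (by norm_num), ENNReal.ofReal_ofNat]
      gcongr
      have : Ioi (1 - 1 / ((n:ℝ)+1)^2) ∩ Ico 0 1 ⊆ Ioo (1 - 1 / ((n:ℝ)+1)^2) 1 := by
        rintro x ⟨a, b, c⟩; exact ⟨a, c⟩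
      refine (measure_mono this).trans ?_
      rw [Real.volume_Ioo]
      exact ENNReal.ofReal_le_ofReal (by linarith)
  · refine ne_top_of_le_ne_top hs.tsum_ofReal_ne_top (ENNReal.tsum_le_tsum fun n => ?_)
    rw [Measure.restrict_apply' measurableSet_Ico]
    refine (gauss_meas _ measurableSet_Iio n).trans ?_
    rw [ENNReal.ofReal_mul (by norm_num), ENNReal.ofReal_ofNat]
    gcongr
    have : Iio (1 / ((n:ℝ)+1)^2) ∩ Ico 0 1 ⊆ Ico 0 (1 / ((n:ℝ)+1)^2) := by
      rintro x ⟨a, b, c⟩; exact ⟨b, a⟩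
    refine (measure_mono this).trans ?_
    rw [Real.volume_Ico]
    exact ENNReal.ofReal_le_ofReal (by linarith)
lemma beta_iter_mem (β : ℝ) (n : ℕ) (x : ℝ) (hx : x ∈ Ico (0:ℝ) 1) : (betaT β)^[n] x ∈ Ico (0:ℝ) 1 := by
  cases n with
  | zero => simpa using hx
  | succ n => rw [Function.iterate_succ_apply']; exact ⟨betaT_nonneg _ _, betaT_lt_one _ _⟩

lemma lZero_le (β : ℝ) (hβ : 1 < β) (n : ℕ) (x : ℝ) (hx : x ∈ Ico (0:ℝ) 1) (δ : ℝ) (hδ : 0 < δ)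
    (h : δ ≤ (betaT β)^[n] x) : (lZero β n x : ℝ) ≤ Real.log (1/δ) / Real.log β := by
  set S := {k | ∀ j, 1 ≤ j → j ≤ k → betaEps β (n + j) x = 0} with hS
  have hlog : 0 < Real.log β := Real.log_pos hβ
  have hb : ∀ k ∈ S, (k:ℝ) ≤ Real.log (1/δ) / Real.log β := by
    intro k hk
    have key : ∀ i ≤ k, (betaT β)^[n+i] x = β^i * (betaT β)^[n] x := by
      intro i
      induction i with
      | zero => intro _; simp
      | succ i ih =>
        intro hi
        have h1 := hk (i+1) (by omega) hi
        unfold betaEps at h1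
        rw [show n + (i+1) - 1 = n + i by omega] at h1
        rw [show n + (i+1) = (n+i)+1 by ring, Function.iterate_succ_apply', betaT, h1, ih (by omega)]
        push_cast; ring
    have h2 := (beta_iter_mem β (n+k) x hx).2
    rw [key k le_rfl] at h2
    have h3 : β^k * δ < 1 := lt_of_le_of_lt (mul_le_mul_of_nonneg_left h (by positivity)) h2
    rw [le_div_iff₀ hlog, ← Real.log_pow]
    refine Real.log_le_log (by positivity) ?_
    rw [le_div_iff₀ hδ]; exact h3.le
  have hmem : lZero β n x ∈ S := by
    refine Nat.sSup_mem ⟨0, ?_⟩ ⟨⌊Real.log (1/δ) / Real.log β⌋₊, ?_⟩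
    · intro j h1 h2; omega
    · intro k hk; exact Nat.le_floor (hb k hk)
  exact hb _ hmem

lemma betaEps_succ (β : ℝ) (i : ℕ) (hi : 1 ≤ i) (x : ℝ) : betaEps β (i+1) x = betaEps β i (betaT β x) := by
  unfold betaEps
  obtain ⟨j, rfl⟩ : ∃ j, i = j + 1 := ⟨i-1, by omega⟩
  simp

lemma betaT_le (β : ℝ) (hβ : 1 < β) (x : ℝ) (hx : 0 ≤ x) : betaT β x ≤ β * x := by
  unfold betaT
  have : (0:ℤ) ≤ ⌊β * x⌋ := Int.floor_nonneg.2 (by positivity)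
  have : (0:ℝ) ≤ (⌊β * x⌋:ℝ) := by exact_mod_cast this
  linarith

lemma beta_iter_le (β : ℝ) (hβ : 1 < β) (n : ℕ) : ∀ (x : ℝ), 0 ≤ x → (betaT β)^[n] x ≤ β^n * x := by
  induction n with
  | zero => intro x hx; simp
  | succ n ih =>
    intro x hx
    rw [Function.iterate_succ_apply]
    refine (ih _ (betaT_nonneg _ _)).trans ?_
    have := mul_le_mul_of_nonneg_left (betaT_le β hβ x hx) (by positivity : 0 ≤ β^n)
    rw [pow_succ]; linarith

lemma left_digits (β : ℝ) (hβ : 1 < β) (n : ℕ) : ∀ (x y : ℝ), 0 ≤ x → y ≤ x →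
    β^n * (x - y) ≤ (betaT β)^[n] x → ∀ i, 1 ≤ i → i ≤ n → betaEps β i y = betaEps β i x := by
  induction n with
  | zero => intro x y _ _ _ i h1 h2; omega
  | succ n ih =>
    intro x y hx hyx h i h1 h2
    rw [Function.iterate_succ_apply] at h
    have hT := betaT_nonneg β x
    have h3 := h.trans (beta_iter_le β hβ n _ hT)
    have h4 : β * (x - y) ≤ betaT β x := by
      rw [pow_succ, mul_assoc] at h3
      exact le_of_mul_le_mul_left h3 (by positivity)
    have hfl : ⌊β * y⌋ = ⌊β * x⌋ := by
      rw [Int.floor_eq_iff]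
      constructor
      · unfold betaT at h4; linarith
      · have := Int.lt_floor_add_one (β * x)
        nlinarith
    have hTy : betaT β x - betaT β y = β * (x - y) := by
      unfold betaT; rw [hfl]; ring
    obtain ⟨j, rfl⟩ : ∃ j, i = j + 1 := ⟨i-1, by omega⟩
    rcases Nat.eq_zero_or_pos j with rfl | hj
    · simpa [betaEps] using hfl
    · rw [betaEps_succ β j hj, betaEps_succ β j hj]
      refine ih _ _ hT ?_ ?_ j hj (by omega)
      · nlinarith
      · rw [hTy, ← mul_assoc, ← pow_succ]; exact h

/-- The left endpoint is in the cylinder. -/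
lemma left_mem (β : ℝ) (hβ : 1 < β) (n : ℕ) (x : ℝ) (hx : x ∈ Ico (0:ℝ) 1) :
    x - (betaT β)^[n] x / β^n ∈ betaCyl β n x := by
  have hp : 0 < β^n := by positivity
  have h1 := beta_iter_le β hβ n x hx.1
  have h0 := (beta_iter_mem β n x hx).1
  have h2 : (betaT β)^[n] x / β^n ≤ x := by rw [div_le_iff₀ hp]; linarith
  have h3 : 0 ≤ (betaT β)^[n] x / β^n := by positivity
  refine ⟨⟨by linarith, by linarith [hx.2]⟩, left_digits β hβ n _ _ hx.1 (by linarith) ?_⟩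
  rw [sub_sub_cancel, mul_div_cancel₀ _ hp.ne']

lemma cyl_diff (β : ℝ) (n : ℕ) : ∀ (x y : ℝ), (∀ i, 1 ≤ i → i ≤ n → betaEps β i y = betaEps β i x) →
    (betaT β)^[n] x - (betaT β)^[n] y = β^n * (x - y) := by
  induction n with
  | zero => intro x y _; simp
  | succ n ih =>
    intro x y h
    rw [Function.iterate_succ_apply', Function.iterate_succ_apply']
    have h1 := ih x y (fun i a b => h i a (by omega))
    have h2 := h (n+1) (by omega) le_rfl
    simp only [betaEps, Nat.add_sub_cancel] at h2
    rw [betaT, betaT, h2, pow_succ]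
    linear_combination β * h1

lemma cyl_dist (β : ℝ) (hβ : 1 < β) (n : ℕ) (x y : ℝ) (hx : x ∈ Ico (0:ℝ) 1) (hy : y ∈ betaCyl β n x) :
    β^n * |x - y| ≤ 1 := by
  have h := cyl_diff β n x y hy.2
  have a := beta_iter_mem β n x hx
  have b := beta_iter_mem β n y hy.1
  rw [← abs_of_pos (by positivity : 0 < β^n), ← abs_mul, ← h, abs_le]
  constructor <;> linarith [a.1, a.2, b.1, b.2]
lemma gauss_irr (x : ℝ) (hx : Irrational x) : Irrational (gaussMap x) := by
  unfold gaussMap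
  rw [if_neg hx.ne_zero, one_div]
  exact hx.inv.sub_intCast _

lemma gauss_iter_irr (x : ℝ) (hx : Irrational x) (n : ℕ) : Irrational (gaussMap^[n] x) := by
  induction n with
  | zero => simpa using hx
  | succ n ih => rw [Function.iterate_succ_apply']; exact gauss_irr _ ih

lemma gauss_iter_mem' (x : ℝ) (h : x ∈ Ico (0:ℝ) 1) (n : ℕ) : gaussMap^[n] x ∈ Ico (0:ℝ) 1 := by
  cases n with
  | zero => simpa using h
  | succ n => rw [Function.iterate_succ_apply']; exact ⟨gauss_nonneg _, gauss_lt_one _⟩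

lemma gauss_iter_mem (x : ℝ) (hx : Irrational x) (h : x ∈ Ico (0:ℝ) 1) (n : ℕ) :
    gaussMap^[n] x ∈ Ioo (0:ℝ) 1 := by
  have := gauss_iter_mem' x h n
  exact ⟨lt_of_le_of_ne this.1 (gauss_iter_irr x hx n).ne_zero.symm, this.2⟩

lemma cfA_pos (x : ℝ) (hx : Irrational x) (h : x ∈ Ico (0:ℝ) 1) (n : ℕ) : 1 ≤ cfA (n+1) x := by
  have h1 := gauss_iter_mem x hx h n
  unfold cfA
  rw [Nat.add_sub_cancel, Int.le_floor]; push_cast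
  rw [le_div_iff₀ h1.1]; linarith [h1.2]

/-- `q_{m-1}`. -/
noncomputable def qp (x : ℝ) : ℕ → ℤ
  | 0 => 0
  | (n+1) => cfQ x n

/-- `p_{m-1}`. -/
noncomputable def pp (x : ℝ) : ℕ → ℤ
  | 0 => 1
  | (n+1) => cfP x n

lemma qp_succ (x : ℝ) (m : ℕ) : qp x (m+1) = cfQ x m := rfl

lemma pp_succ (x : ℝ) (m : ℕ) : pp x (m+1) = cfP x m := rfl

lemma cfQ_succ (x : ℝ) (m : ℕ) : cfQ x (m+1) = cfA (m+1) x * cfQ x m + qp x m := by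
  cases m with
  | zero => simp [cfQ, qp]
  | succ m => simp [cfQ, qp]

lemma cfP_succ (x : ℝ) (m : ℕ) : cfP x (m+1) = cfA (m+1) x * cfP x m + pp x m := by
  cases m with
  | zero => simp [cfP, pp]
  | succ m => simp [cfP, pp]

lemma q_bounds (x : ℝ) (hx : Irrational x) (h : x ∈ Ico (0:ℝ) 1) (m : ℕ) :
    0 ≤ qp x m ∧ qp x m ≤ cfQ x m ∧ 1 ≤ cfQ x m := by
  induction m with
  | zero => simp [qp, cfQ]
  | succ m ih =>
    have ha := cfA_pos x hx h m
    obtain ⟨h1, h2, h3⟩ := ih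
    have : cfQ x m ≤ cfA (m+1) x * cfQ x m := by nlinarith
    rw [cfQ_succ]
    simp only [qp_succ]
    exact ⟨by linarith, by linarith, by linarith⟩

lemma q_exp (x : ℝ) (hx : Irrational x) (h : x ∈ Ico (0:ℝ) 1) (m : ℕ) :
    (2:ℤ)^m ≤ 2 * (cfQ x m)^2 := by
  induction m using Nat.twoStepInduction with
  | zero => simp [cfQ]
  | one => 
    have := (q_bounds x hx h 1).2.2
    nlinarith
  | more m ih _ =>
    have h1 := q_bounds x hx h m
    have h2 := q_bounds x hx h (m+1)
    have ha := cfA_pos x hx h (m+1)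
    have e := cfQ_succ x (m+1)
    simp only [qp_succ] at e h2
    have : 2 * cfQ x m ≤ cfQ x (m+2) := by
      rw [e]; nlinarith
    rw [pow_add]
    nlinarith

lemma det_eq (x : ℝ) (m : ℕ) : 
    ((pp x m * cfQ x m - cfP x m * qp x m : ℤ) : ℝ) = (-1:ℝ)^m := by
  induction m with
  | zero => simp [pp, qp, cfP, cfQ]
  | succ m ih =>
    rw [cfQ_succ, cfP_succ]
    simp only [pp_succ, qp_succ]
    push_cast at *
    rw [pow_succ]
    linear_combination -ih

/-- The inverse branch. -/
noncomputable def ph (x : ℝ) (m : ℕ) (s : ℝ) : ℝ :=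
  (cfP x m + pp x m * s) / (cfQ x m + qp x m * s)

lemma ph_den (x : ℝ) (hx : Irrational x) (h : x ∈ Ico (0:ℝ) 1) (m : ℕ) (s : ℝ) (hs : 0 ≤ s) :
    (cfQ x m : ℝ) ≤ cfQ x m + qp x m * s := by
  have : (0:ℝ) ≤ qp x m := by exact_mod_cast (q_bounds x hx h m).1
  nlinarith

lemma ph_den' (x : ℝ) (hx : Irrational x) (h : x ∈ Ico (0:ℝ) 1) (m : ℕ) (s : ℝ) (hs : s ≤ 1) :
    (cfQ x m + qp x m * s : ℝ) ≤ 2 * cfQ x m := by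
  have h0 : (0:ℝ) ≤ qp x m := by exact_mod_cast (q_bounds x hx h m).1
  have h1 : (qp x m : ℝ) ≤ cfQ x m := by exact_mod_cast (q_bounds x hx h m).2.1
  nlinarith

lemma q_posR (x : ℝ) (hx : Irrational x) (h : x ∈ Ico (0:ℝ) 1) (m : ℕ) : (1:ℝ) ≤ cfQ x m := by
  exact_mod_cast (q_bounds x hx h m).2.2

lemma ph_succ (x : ℝ) (hx : Irrational x) (h : x ∈ Ico (0:ℝ) 1) (m : ℕ) (s : ℝ) (hs : 0 ≤ s) :
    ph x (m+1) s = ph x m (1 / (cfA (m+1) x + s)) := by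
  have ha : (1:ℝ) ≤ cfA (m+1) x := by exact_mod_cast cfA_pos x hx h m
  have hpos : 0 < (cfA (m+1) x : ℝ) + s := by linarith
  have d1 := ph_den x hx h (m+1) s hs
  have d2 := ph_den x hx h m (1 / (cfA (m+1) x + s)) (by positivity)
  have q1 := q_posR x hx h (m+1)
  have q2 := q_posR x hx h m
  unfold ph
  rw [div_eq_div_iff (by linarith) (by linarith)]
  rw [cfQ_succ, cfP_succ]
  simp only [pp_succ, qp_succ]
  push_cast
  field_simp
  ring

/-- Points of the cylinder are in the image of the inverse branch. -/
lemma ph_of_mem (x : ℝ) (hx : Irrational x) (h : x ∈ Ico (0:ℝ) 1) (y : ℝ) (m : ℕ)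
    (hy : y ∈ cfCyl m x) : y = ph x m (gaussMap^[m] y) := by
  induction m with
  | zero => simp [ph, pp, qp, cfP, cfQ]
  | succ m ih =>
    have h1 : y ∈ cfCyl m x := ⟨hy.1, fun i a b => hy.2 i a (by omega)⟩
    have h2 := hy.2 (m+1) (by omega) le_rfl
    have ha := cfA_pos x hx h m
    have hne : gaussMap^[m] y ≠ 0 := by
      intro h0
      rw [← h2, cfA, Nat.add_sub_cancel, h0] at ha
      simp at ha
    rw [Function.iterate_succ_apply', ph_succ x hx h m _ (gauss_nonneg _)]
    have h3 : (cfA (m+1) x : ℝ) + gaussMap (gaussMap^[m] y) = 1 / gaussMap^[m] y := by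
      rw [← h2, cfA, Nat.add_sub_cancel]
      conv_lhs => rw [gaussMap, if_neg hne]
      ring
    rw [h3, one_div_one_div]
    exact ih h1

/-- Image of the inverse branch is in the cylinder. -/
lemma ph_mem (x : ℝ) (hx : Irrational x) (h : x ∈ Ico (0:ℝ) 1) (m : ℕ) : ∀ s ∈ Ioo (0:ℝ) 1,
    gaussMap^[m] (ph x m s) = s ∧ ∀ i, 1 ≤ i → i ≤ m → cfA i (ph x m s) = cfA i x := by
  induction m with
  | zero =>
    intro s hs
    refine ⟨by simp [ph, pp, qp, cfP, cfQ], fun i a b => by omega⟩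
  | succ m ih =>
    intro s hs
    have ha : (1:ℝ) ≤ cfA (m+1) x := by exact_mod_cast cfA_pos x hx h m
    have hpos : 0 < (cfA (m+1) x : ℝ) + s := by linarith [hs.1]
    rw [ph_succ x hx h m s hs.1.le]
    have hs' : 1 / ((cfA (m+1) x : ℝ) + s) ∈ Ioo (0:ℝ) 1 := by
      refine ⟨by positivity, ?_⟩
      rw [div_lt_one hpos]; linarith [hs.1]
    obtain ⟨i1, i2⟩ := ih _ hs'
    have hfl : ⌊(cfA (m+1) x : ℝ) + s⌋ = cfA (m+1) x := by
      rw [Int.floor_eq_iff]; constructor <;> linarith [hs.1, hs.2]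
    constructor
    · rw [Function.iterate_succ_apply', i1, gaussMap, if_neg hs'.1.ne', one_div_one_div, hfl]
      ring
    · intro i a b
      rcases Nat.lt_or_ge i (m+1) with hi | hi
      · exact i2 i a (by omega)
      · obtain rfl : i = m+1 := by omega
        conv_lhs => rw [cfA, Nat.add_sub_cancel, i1, one_div_one_div, hfl]

lemma ph_sub (x : ℝ) (hx : Irrational x) (h : x ∈ Ico (0:ℝ) 1) (m : ℕ) (s t : ℝ) 
    (hs : 0 ≤ s) (ht : 0 ≤ t) : ph x m s - ph x m t =
      (-1)^m * (s - t) / ((cfQ x m + qp x m * s) * (cfQ x m + qp x m * t)) := by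
  have d1 := ph_den x hx h m s hs
  have d2 := ph_den x hx h m t ht
  have q2 := q_posR x hx h m
  have n1 : (cfQ x m + qp x m * s : ℝ) ≠ 0 := by linarith
  have n2 : (cfQ x m + qp x m * t : ℝ) ≠ 0 := by linarith
  have hd := det_eq x m
  unfold ph
  rw [div_sub_div _ _ n1 n2, ← hd]
  push_cast
  congr 1
  ring

lemma self_mem (m : ℕ) (x : ℝ) (h : x ∈ Ico (0:ℝ) 1) : x ∈ cfCyl m x := ⟨h, fun _ _ _ => rfl⟩

lemma cf_upper (x : ℝ) (hx : Irrational x) (h : x ∈ Ico (0:ℝ) 1) (m : ℕ) (y : ℝ)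
    (hy : y ∈ cfCyl m x) : |x - y| * (cfQ x m : ℝ)^2 ≤ 1 := by
  have hq := q_posR x hx h m
  have a := gauss_iter_mem' x h m
  have b := gauss_iter_mem' y hy.1 m
  have d1 := ph_den x hx h m _ a.1
  have d2 := ph_den x hx h m _ b.1
  rw [ph_of_mem x hx h y m hy]
  nth_rewrite 1 [ph_of_mem x hx h x m (self_mem m x h)]
  rw [ph_sub x hx h m _ _ a.1 b.1, abs_div, abs_mul, abs_pow, abs_neg, abs_one, one_pow, one_mul,
    div_mul_eq_mul_div, div_le_one (by rw [abs_pos]; apply ne_of_gt; exact mul_pos (by linarith) (by linarith)),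
    abs_of_pos (mul_pos (by linarith) (by linarith) : 0 < ((cfQ x m + qp x m * gaussMap^[m] x) * (cfQ x m + qp x m * gaussMap^[m] y) : ℝ))]
  have h1 : |gaussMap^[m] x - gaussMap^[m] y| ≤ 1 := by
    rw [abs_le]; constructor <;> linarith [a.1, a.2, b.1, b.2]
  calc _ ≤ 1 * (cfQ x m : ℝ)^2 := by gcongr
    _ = (cfQ x m : ℝ) * cfQ x m := by ring
    _ ≤ _ := mul_le_mul d1 d2 (by linarith) (by linarith)

lemma cf_lower (x : ℝ) (hx : Irrational x) (h : x ∈ Ico (0:ℝ) 1) (m : ℕ) (y : ℝ) (hy0 : y ∈ Ico (0:ℝ) 1)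
    (hy : y ∉ cfCyl m x) (r : ℝ) (hr1 : r ≤ gaussMap^[m] x) (hr2 : r ≤ 1 - gaussMap^[m] x) :
    r ≤ 4 * (cfQ x m : ℝ)^2 * |x - y| := by
  by_contra hcon
  push Not at hcon
  apply hy
  set t := gaussMap^[m] x with ht
  set q : ℝ := ((cfQ x m : ℤ) : ℝ) with hq
  set q' : ℝ := ((qp x m : ℤ) : ℝ) with hq'
  have hq1 : 1 ≤ q := q_posR x hx h m
  have b0 : 0 ≤ q' := by rw [hq']; exact_mod_cast (q_bounds x hx h m).1
  have b1 : q' ≤ q := by rw [hq', hq]; exact_mod_cast (q_bounds x hx h m).2.1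
  have a := gauss_iter_mem x hx h m
  have d1 := ph_den x hx h m _ a.1.le
  have d2 := ph_den' x hx h m _ a.2.le
  rw [← ht, ← hq, ← hq'] at d1 d2
  rw [← ht] at a
  set d := (-1:ℝ)^m * (y - x) * (q + q' * t) with hd
  have hdabs : |d| ≤ |x - y| * (2 * q) := by
    rw [hd, abs_mul, abs_mul, abs_pow, abs_neg, abs_one, one_pow, one_mul, abs_sub_comm,
      abs_of_pos (by linarith : 0 < q + q' * t)]
    gcongr
  have hdq : |d| * (2 * q) < r := by
    calc _ ≤ |x - y| * (2 * q) * (2 * q) := by gcongr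
      _ = 4 * q^2 * |x-y| := by ring
      _ < r := hcon
  have hd1 : |d| * q' ≤ |d| * q := by gcongr
  have n1 : |d * q| = |d| * q := by rw [abs_mul, abs_of_pos (by linarith : 0 < q)]
  have n2 : |d * q'| = |d| * q' := by rw [abs_mul, abs_of_nonneg b0]
  have l1 := abs_le.1 n1.le
  have l2 := abs_le.1 n2.le
  have nn : 0 ≤ |d| * q := by positivity
  have hden : 0 < 1 - d * q' := by linarith [l2.2, a.2]
  set s := (t + d * q) / (1 - d * q') with hs
  have hs0 : 0 < s := div_pos (by linarith [l1.1]) hden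
  have hs1 : s < 1 := by rw [hs, div_lt_one hden]; linarith [l1.2, l2.2]
  have hse : s * (1 - d * q') = t + d * q := by rw [hs]; field_simp
  have hyp : y = ph x m s := by
    have e := ph_sub x hx h m s t hs0.le a.1.le
    rw [← ph_of_mem x hx h x m (self_mem m x h), ← hq, ← hq'] at e
    have d3 := ph_den x hx h m s hs0.le
    rw [← hq, ← hq'] at d3
    have e2 : s - t = d * (q + q' * s) := by linear_combination hse
    have hsq : ((-1:ℝ)^m) * (-1)^m = 1 := by rw [← mul_pow]; simp
    have e3 : (-1)^m * (s - t) / ((q + q' * s) * (q + q' * t)) = y - x := by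
      rw [div_eq_iff (mul_ne_zero (by linarith) (by linarith)), e2, hd]
      linear_combination ((y - x) * (q + q' * t) * (q + q' * s)) * hsq
    linarith
  refine ⟨hy0, ?_⟩
  rw [hyp]
  exact (ph_mem x hx h m s ⟨hs0, hs1⟩).2
lemma unif_const (u v : ℕ → ℝ) (hu : ∀ m, 0 < u m) (hv0 : ∀ m, 0 ≤ v m) (hv1 : ∀ m, v m ≤ 1)
    (h : ∀ᶠ m in atTop, v m ≤ u m) : ∃ c, 0 < c ∧ ∀ m, c * v m ≤ u m := by
  obtain ⟨M, hM⟩ := eventually_atTop.1 h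
  have key : ∀ M : ℕ, ∃ c : ℝ, 0 < c ∧ c ≤ 1 ∧ ∀ m < M, c ≤ u m := by
    intro M
    induction M with
    | zero => exact ⟨1, one_pos, le_rfl, fun m hm => by omega⟩
    | succ M ih =>
      obtain ⟨c, h1, h2, h3⟩ := ih
      refine ⟨min c (u M), lt_min h1 (hu M), (min_le_left _ _).trans h2, fun m hm => ?_⟩
      rcases Nat.lt_or_ge m M with hh | hh
      · exact (min_le_left _ _).trans (h3 m hh)
      · obtain rfl : m = M := by omega
        exact min_le_right _ _
  obtain ⟨c, h1, h2, h3⟩ := key M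
  refine ⟨c, h1, fun m => ?_⟩
  rcases Nat.lt_or_ge m M with hh | hh
  · have := h3 m hh
    nlinarith [hv0 m, hv1 m]
  · have := hM m hh
    nlinarith [hv0 m, hv1 m]

lemma tail_lim (f : ℕ → ℝ) (A B : ℝ) (h : ∀ᶠ n : ℕ in atTop, |f n| ≤ A + B * Real.log n) :
    Tendsto (fun n : ℕ => f n / Real.sqrt (n * Real.log (Real.log n))) atTop (nhds 0) := by
  have hl : Tendsto (fun n : ℕ => (A + B * Real.log n) / Real.sqrt n) atTop (nhds 0) := by
    have h1 : Tendsto (fun n : ℕ => Real.sqrt n) atTop atTop :=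
      Real.tendsto_sqrt_atTop.comp tendsto_natCast_atTop_atTop
    have h2 : Tendsto (fun n : ℕ => A / Real.sqrt n) atTop (nhds 0) := h1.const_div_atTop A
    have h3 : Tendsto (fun x : ℝ => Real.log x / x ^ (1/2:ℝ)) atTop (nhds 0) :=
      (isLittleO_log_rpow_atTop (by norm_num : (0:ℝ) < 1/2)).tendsto_div_nhds_zero
    have h4 := (h3.comp (tendsto_natCast_atTop_atTop (R := ℝ))).const_mul B
    have h5 := h2.add h4
    rw [mul_zero, add_zero] at h5
    refine h5.congr fun n => ?_
    simp only [Function.comp, Real.sqrt_eq_rpow]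
    ring
  have hll : Tendsto (fun n : ℕ => Real.log (Real.log n)) atTop atTop :=
    Real.tendsto_log_atTop.comp (Real.tendsto_log_atTop.comp tendsto_natCast_atTop_atTop)
  refine squeeze_zero_norm' ?_ hl
  filter_upwards [h, hll.eventually_ge_atTop 1, eventually_ge_atTop 1] with n h1 h2 h3
  have h3' : (1:ℝ) ≤ n := by exact_mod_cast h3
  have hs : Real.sqrt n ≤ Real.sqrt (n * Real.log (Real.log n)) :=
    Real.sqrt_le_sqrt (by nlinarith)
  have hp : 0 < Real.sqrt n := Real.sqrt_pos.2 (by linarith)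
  rw [norm_div, Real.norm_eq_abs, Real.norm_eq_abs, abs_of_nonneg (Real.sqrt_nonneg (n * Real.log (Real.log n)))]
  exact div_le_div₀ ((abs_nonneg _).trans h1) h1 hp hs

lemma q_step_le (x : ℝ) (hx : Irrational x) (h : x ∈ Ico (0:ℝ) 1) (m : ℕ) :
    (cfQ x (m+1) : ℝ) * gaussMap^[m] x ≤ 2 * cfQ x m := by
  have a := gauss_iter_mem x hx h m
  have b := q_bounds x hx h m
  have b1 : (qp x m : ℝ) ≤ cfQ x m := by exact_mod_cast b.2.1
  have b2 := q_posR x hx h m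
  have hA : (cfA (m+1) x : ℝ) * gaussMap^[m] x ≤ 1 := by
    rw [← le_div_iff₀ a.1, cfA, Nat.add_sub_cancel]
    exact Int.floor_le _
  rw [cfQ_succ]
  push_cast
  nlinarith [a.1, a.2]

lemma main_bound (β : ℝ) (hβ : 1 < β) (x : ℝ) (hx : Irrational x) (h : x ∈ Ico (0:ℝ) 1) (c : ℝ) (hc : 0 < c)
    (hG : ∀ m : ℕ, c * (1 / ((m:ℝ)+1)^2) ≤ min (gaussMap^[m] x) (1 - gaussMap^[m] x))
    (n : ℕ) (hn : 1 ≤ n) (hB : 1 / (n:ℝ)^2 ≤ (betaT β)^[n] x) :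
    |Real.log (cfQ x (kCF β n x)) - (Real.log β / 2) * n| ≤
      |Real.log 16 + 6 * Real.log ((Real.log 2 + Real.log β + 2) / Real.log 2 + 2) - 3 * Real.log c| 
        + 3 * Real.log n := by
  have hn' : (1:ℝ) ≤ n := by exact_mod_cast hn
  have hn0 : (n:ℝ) ≠ 0 := by positivity
  have hlogn : 0 ≤ Real.log n := Real.log_nonneg hn'
  have hlognle : Real.log n ≤ n := (Real.log_le_sub_one_of_pos (by linarith)).trans (by linarith)
  have hl2 : 0 < Real.log 2 := Real.log_pos (by norm_num)
  have hlb : 0 < Real.log β := Real.log_pos hβ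
  have hβn : 0 < β^n := by positivity
  set S := {m | betaCyl β n x ⊆ cfCyl m x} with hS
  have hup : ∀ m ∈ S, 2 * Real.log (cfQ x m) ≤ n * Real.log β + 2 * Real.log n := by
    intro m hm
    have h1 := cf_upper x hx h m _ (hm (left_mem β hβ n x h))
    have hq := q_posR x hx h m
    rw [sub_sub_cancel, abs_of_nonneg (div_nonneg (by linarith [(beta_iter_mem β n x h).1]) hβn.le)] at h1
    have h2 : (1 / (n:ℝ)^2) / β^n * (cfQ x m : ℝ)^2 ≤ 1 := by
      refine le_trans ?_ h1
      gcongr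
    have h3 : (cfQ x m : ℝ)^2 ≤ β^n * (n:ℝ)^2 := by
      have : (1 / (n:ℝ)^2) / β^n * (cfQ x m : ℝ)^2 = (cfQ x m : ℝ)^2 / (β^n * (n:ℝ)^2) := by
        field_simp
      rw [this, div_le_one (by positivity)] at h2
      exact h2
    have h4 := Real.log_le_log (by positivity) h3
    rw [Real.log_mul (by positivity) (by positivity), Real.log_pow, Real.log_pow, Real.log_pow] at h4
    exact_mod_cast h4
  have hmle : ∀ m ∈ S, (m:ℝ) ≤ (Real.log 2 + Real.log β + 2) / Real.log 2 * n := by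
    intro m hm
    have h1 := hup m hm
    have hq := q_posR x hx h m
    have h2 : (2:ℝ)^m ≤ 2 * (cfQ x m : ℝ)^2 := by exact_mod_cast q_exp x hx h m
    have h3 := Real.log_le_log (by positivity) h2
    rw [Real.log_mul (by norm_num) (by positivity), Real.log_pow, Real.log_pow] at h3
    push_cast at h3
    rw [div_mul_eq_mul_div, le_div_iff₀ hl2]
    nlinarith
  have hbdd : BddAbove S := ⟨⌊(Real.log 2 + Real.log β + 2) / Real.log 2 * n⌋₊, fun k hk => Nat.le_floor (hmle k hk)⟩
  have hkS : kCF β n x ∈ S := by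
    refine Nat.sSup_mem ⟨0, ?_⟩ hbdd
    intro y hy
    exact ⟨hy.1, fun i a b => by omega⟩
  have hkS' : kCF β n x + 1 ∉ S := by
    intro hh
    have : kCF β n x + 1 ≤ kCF β n x := le_csSup hbdd hh
    omega
  set k := kCF β n x with hk
  have hub := hup k hkS
  have hkle := hmle k hkS
  obtain ⟨y, hyJ, hyI⟩ := not_subset.1 hkS'
  have hd := cyl_dist β hβ n x y h hyJ
  have hg := hG (k+1)
  have hg0 := (hG k).trans (min_le_left _ _)
  have hlow := cf_lower x hx h (k+1) y hyJ.1 hyI _ (hg.trans (min_le_left _ _)) (hg.trans (min_le_right _ _))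
  have hq := q_posR x hx h k
  have hq1 := q_posR x hx h (k+1)
  have hst := q_step_le x hx h k
  push_cast at hlow
  set K : ℝ := (k:ℝ) + 2 with hK
  have hK2 : 2 ≤ K := by have : (0:ℝ) ≤ k := by positivity
                         linarith
  have hKe : (k:ℝ) + 1 + 1 = K := by rw [hK]; ring
  rw [hKe] at hlow
  -- `q_{k+1} ≤ 2 K^2 / c * q_k`
  have s1 : c * (cfQ x (k+1) : ℝ) ≤ 2 * K^2 * cfQ x k := by
    have e1 : c * (1 / K^2) ≤ gaussMap^[k] x := by
      refine le_trans ?_ hg0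
      have : (k:ℝ) + 1 ≤ K := by linarith
      gcongr
    have e2 : (cfQ x (k+1) : ℝ) * (c * (1 / K^2)) ≤ 2 * cfQ x k :=
      (mul_le_mul_of_nonneg_left e1 (by linarith)).trans hst
    have e3 : (cfQ x (k+1) : ℝ) * (c * (1 / K^2)) = c * cfQ x (k+1) / K^2 := by ring
    rw [e3, div_le_iff₀ (by positivity)] at e2
    linarith
  have s2 : β^n * c ≤ 4 * (cfQ x (k+1) : ℝ)^2 * K^2 := by
    have e1 : c ≤ 4 * (cfQ x (k+1) : ℝ)^2 * |x - y| * K^2 := by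
      rw [mul_one_div, div_le_iff₀ (by positivity)] at hlow
      exact hlow
    calc β^n * c ≤ β^n * (4 * (cfQ x (k+1) : ℝ)^2 * |x - y| * K^2) := by gcongr
      _ = (β^n * |x - y|) * (4 * (cfQ x (k+1) : ℝ)^2 * K^2) := by ring
      _ ≤ 1 * (4 * (cfQ x (k+1) : ℝ)^2 * K^2) := by gcongr
      _ = _ := by ring
  have s3 : β^n * c^3 ≤ 16 * K^6 * (cfQ x k : ℝ)^2 := by
    calc β^n * c^3 = (β^n * c) * c^2 := by ring
      _ ≤ (4 * (cfQ x (k+1) : ℝ)^2 * K^2) * c^2 := by gcongr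
      _ = 4 * K^2 * (c * (cfQ x (k+1) : ℝ))^2 := by ring
      _ ≤ 4 * K^2 * (2 * K^2 * cfQ x k)^2 := by gcongr
      _ = _ := by ring
  have s4 := Real.log_le_log (by positivity) s3
  rw [Real.log_mul (by positivity) (by positivity), Real.log_mul (by positivity) (by positivity),
    Real.log_mul (by positivity) (by positivity), Real.log_pow, Real.log_pow, Real.log_pow, Real.log_pow] at s4
  push_cast at s4
  have s5 : Real.log K ≤ Real.log ((Real.log 2 + Real.log β + 2) / Real.log 2 + 2) + Real.log n := by
    rw [← Real.log_mul (by positivity) (by positivity)]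
    refine Real.log_le_log (by linarith) ?_
    linarith
  have s6 := le_abs_self (Real.log 16 + 6 * Real.log ((Real.log 2 + Real.log β + 2) / Real.log 2 + 2) - 3 * Real.log c)
  have s7 := abs_nonneg (Real.log 16 + 6 * Real.log ((Real.log 2 + Real.log β + 2) / Real.log 2 + 2) - 3 * Real.log c)
  rw [abs_le]
  constructor <;> linarith

theorem ln_and_log_q_kn_loglog (β : ℝ) (hβ : 1 < β) :
    ∀ᵐ x ∂(volume.restrict (Set.Ico (0:ℝ) 1)),
      Tendsto (fun n : ℕ =>
          (lZero β n x : ℝ) / Real.sqrt (n * Real.log (Real.log n))) atTop (nhds 0) ∧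
      Tendsto (fun n : ℕ =>
          (Real.log (cfQ x (kCF β n x)) - (Real.log β / 2) * n) /
            Real.sqrt (n * Real.log (Real.log n))) atTop (nhds 0) := by
  have hirr : ∀ᵐ x ∂(volume.restrict (Set.Ico (0:ℝ) 1)), Irrational x := by
    refine ae_restrict_of_ae ?_
    have : volume (Set.range ((↑) : ℚ → ℝ)) = 0 := (Set.countable_range _).measure_zero _
    exact measure_eq_zero_iff_ae_notMem.1 this
  filter_upwards [beta_ae β hβ, gauss_ae, hirr, ae_restrict_mem measurableSet_Ico] with x hB hG hx h
  constructor
  · refine tail_lim _ 0 (2 / Real.log β) ?_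
    filter_upwards [hB, eventually_ge_atTop 1] with n hn h1
    have h1' : (1:ℝ) ≤ n := by exact_mod_cast h1
    have := lZero_le β hβ n x h _ (by positivity) hn
    rw [one_div_one_div, Real.log_pow] at this
    rw [abs_of_nonneg (by positivity)]
    refine this.trans (le_of_eq ?_)
    push_cast; ring
  · obtain ⟨c, hc, hcG⟩ := unif_const (fun m => min (gaussMap^[m] x) (1 - gaussMap^[m] x))
      (fun m : ℕ => 1 / ((m:ℝ)+1)^2)
      (fun m => by
        have := gauss_iter_mem x hx h m
        exact lt_min this.1 (by linarith [this.2]))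
      (fun m => by positivity)
      (fun m => by
        have : (0:ℝ) ≤ m := by positivity
        rw [div_le_one (by positivity)]; nlinarith)
      (by filter_upwards [hG] with m hm; exact le_min hm.1 hm.2)
    refine tail_lim _ |Real.log 16 + 6 * Real.log ((Real.log 2 + Real.log β + 2) / Real.log 2 + 2) - 3 * Real.log c| 3 ?_
    filter_upwards [hB, eventually_ge_atTop 1] with n hn h1
    exact main_bound β hβ x hx h c hc hcG n h1 hn
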